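/- There exists a 4-regular graph of girth 7 on 67 vertices. -/

import Mathlib

/-- The adjacency table of the graph, packed into one number: the `j`-th neighbour of vertex `i`
is stored in the 7 bits starting at position `28 * i + 7 * j`. -/
def tbl : ℕ := 2674587036035728570714041459412120757739953951494883634235399169075703262643130554166204338745358452324218058048753930075580014061165815380385324587462635163392550268922123785775284571459863899823240862764216718352021400055166252132947566927525866602999754453631976024104331036447903932839936057651483531181342637397528958822868359290769545932814876647807875107895620563303674696842192221905641940843364600916626140278854158571616330774016460040570501674315287971569964980734096025777518434820459338665893907735651941015319609710783951114998434387987627506236245636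

/-- The `j`-th neighbour of vertex `i`. -/
def nbr (i j : ℕ) : ℕ := (tbl >>> (28 * i + 7 * j)) % 128

def adjB (a b : ℕ) : Bool :=
  Nat.beq (nbr a 0) b || (Nat.beq (nbr a 1) b || (Nat.beq (nbr a 2) b || Nat.beq (nbr a 3) b))

/-- Searching for non-backtracking walks: from the current vertex `c`, reached from `p`,
no non-backtracking walk of at most `k` steps ends in `s`. -/
def noRet (s : ℕ) : ℕ → ℕ → ℕ → Bool
  | 0, _, c => !(Nat.beq c s)
  | k + 1, p, c => !(Nat.beq c s) &&
      ((Nat.beq (nbr c 0) p || noRet s k c (nbr c 0)) &&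
      ((Nat.beq (nbr c 1) p || noRet s k c (nbr c 1)) &&
      ((Nat.beq (nbr c 2) p || noRet s k c (nbr c 2)) &&
      (Nat.beq (nbr c 3) p || noRet s k c (nbr c 3)))))

def allRet : ℕ → Bool
  | 0 => true
  | s + 1 => (noRet s 5 s (nbr s 0) && (noRet s 5 s (nbr s 1) &&
      (noRet s 5 s (nbr s 2) && noRet s 5 s (nbr s 3)))) && allRet s

theorem allRet_67 : allRet 67 = true := by decide +kernel

theorem adjB_symm : ∀ a b : Fin 67, adjB a b = true → adjB b a = true := by decide +kernel

theorem adjB_irrefl : ∀ a : Fin 67, ¬ adjB a a = true := by decide +kernel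

theorem adjB_card : ∀ a : Fin 67,
    (Finset.univ.filter (fun b : Fin 67 => adjB a b = true)).card = 4 := by decide +kernel

def G67 : SimpleGraph (Fin 67) where
  Adj a b := adjB a b = true
  symm := ⟨adjB_symm⟩
  loopless := ⟨adjB_irrefl⟩

instance : DecidableRel G67.Adj := fun a b => inferInstanceAs (Decidable (adjB a b = true))

theorem adjB_iff (a b : ℕ) :
    adjB a b = true ↔ nbr a 0 = b ∨ nbr a 1 = b ∨ nbr a 2 = b ∨ nbr a 3 = b := by
  simp [adjB]

theorem noRet_ne {s k p c : ℕ} (h : noRet s k p c = true) : c ≠ s := by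
  rintro rfl
  cases k <;> simp [noRet] at h

theorem noRet_step {s k p c w : ℕ} (h : noRet s (k + 1) p c = true) (hw : adjB c w = true)
    (hp : w ≠ p) : noRet s k c w = true := by
  rw [adjB_iff] at hw
  simp [noRet] at h
  rcases hw with rfl | rfl | rfl | rfl <;> tauto

theorem allRet_spec {n : ℕ} (h : allRet n = true) {s : ℕ} (hs : s < n) {w : ℕ}
    (hw : adjB s w = true) : noRet s 5 s w = true := by
  induction n with
  | zero => omega
  | succ n ih =>
    simp only [allRet, Bool.and_eq_true] at h
    rcases Nat.lt_succ_iff_lt_or_eq.mp hs with h1 | rfl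
    · exact ih h.2 h1
    · rw [adjB_iff] at hw
      rcases hw with rfl | rfl | rfl | rfl <;> tauto

theorem no_trail {c s : Fin 67} (q : G67.Walk c s) : ∀ (k : ℕ) (p : Fin 67),
    noRet s k p c = true → q.IsTrail → s(p, c) ∉ q.edges → q.length ≤ k → False := by
  induction q with
  | nil => intro k p h _ _ _; exact noRet_ne h rfl
  | @cons c w s hcw q ih =>
    intro k p h ht he hl
    cases k with
    | zero => simp at hl
    | succ k =>
      rw [SimpleGraph.Walk.isTrail_cons] at ht
      rw [SimpleGraph.Walk.edges_cons, List.mem_cons, not_or] at he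
      have hwp : (w : ℕ) ≠ p := by
        intro hh
        apply he.1
        rw [Fin.ext hh, Sym2.eq_swap]
      exact ih k c (noRet_step h hcw hwp) ht.1 ht.2 (by simpa using hl)

theorem seven_le : (7 : ℕ∞) ≤ G67.egirth := by
  rw [SimpleGraph.le_egirth]
  intro a p hp
  by_contra hlt
  have hlt' : p.length < 7 := by
    rw [not_le] at hlt
    exact_mod_cast hlt
  cases p with
  | nil => simp at hp
  | @cons _ w _ h q =>
    have ht := hp.isTrail
    rw [SimpleGraph.Walk.isTrail_cons] at ht
    refine no_trail q 5 a (allRet_spec allRet_67 a.2 h) ht.1 ht.2 ?_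
    simp at hlt'
    omega

def cyc7 : G67.Walk 0 0 :=
  .cons (show G67.Adj 0 4 by decide +kernel) <| .cons (show G67.Adj 4 12 by decide +kernel) <| .cons (show G67.Adj 12 2 by decide +kernel) <| .cons (show G67.Adj 2 33 by decide +kernel) <| .cons (show G67.Adj 33 38 by decide +kernel) <| .cons (show G67.Adj 38 40 by decide +kernel) <| .cons (show G67.Adj 40 0 by decide +kernel) <| .nil

theorem cyc7_isCycle : cyc7.IsCycle := by
  unfold cyc7
  rw [SimpleGraph.Walk.cons_isCycle_iff]
  constructor
  · rw [SimpleGraph.Walk.isPath_def]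
    simp only [SimpleGraph.Walk.support_cons, SimpleGraph.Walk.support_nil]
    decide
  · simp only [SimpleGraph.Walk.edges_cons, SimpleGraph.Walk.edges_nil]
    decide

theorem le_seven : G67.egirth ≤ 7 := by
  have h := SimpleGraph.le_egirth.mp le_rfl _ _ cyc7_isCycle
  simpa [cyc7] using h

open scoped Classical in
/-- There exists a 4-regular graph of girth 7 on 67 vertices. -/
theorem exists_4_7_graph_67 :
    ∃ G : SimpleGraph (Fin 67), G.IsRegularOfDegree 4 ∧ G.egirth = 7 := by
  refine ⟨G67, fun v => ?_, le_antisymm le_seven seven_le⟩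
  rw [← adjB_card v, ← SimpleGraph.card_neighborFinset_eq_degree]
  congr 1
  ext b
  rw [SimpleGraph.mem_neighborFinset, Finset.mem_filter]
  exact ⟨fun h => ⟨Finset.mem_univ _, h⟩, fun h => h.2⟩
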